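/- arXiv:2409.13341 — 10 statements merged into one kernel-verified Lean document; each statement's English description precedes it below -/
import Mathlib

section
/- Let τ_{r₁(m₁),r₂(m₂)} be a class transposition and let n be a positive integer. Then, in the permutation group of ℤ, τ_{r₁(m₁),r₂(m₂)} equals the product over k = 0, 1, …, n − 1 of the class transpositions τ_{km₁+r₁(nm₁), km₂+r₂(nm₂)}; moreover these n factors have pairwise disjoint supports, hence pairwise commute. -/
/-- The permutation of `ℤ` sending `r₁ + m₁ k ↦ r₂ + m₂ k` and `r₂ + m₂ k ↦ r₁ + m₁ k`
for every `k ∈ ℤ`, and fixing every other integer (the class transposition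
`τ_{r₁(m₁), r₂(m₂)}`). -/
def IsClassTransposition (τ : Equiv.Perm ℤ) (r₁ m₁ r₂ m₂ : ℤ) : Prop :=
  (∀ k : ℤ, τ (r₁ + m₁ * k) = r₂ + m₂ * k) ∧
  (∀ k : ℤ, τ (r₂ + m₂ * k) = r₁ + m₁ * k) ∧
  (∀ n : ℤ, (∀ k : ℤ, n ≠ r₁ + m₁ * k) → (∀ k : ℤ, n ≠ r₂ + m₂ * k) → τ n = n)

open Equiv in
theorem Equiv.Perm.list_prod_apply_of_forall_fixed {α : Type*} {l : List (Perm α)} {x : α}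
    (h : ∀ f ∈ l, f x = x) : l.prod x = x := by
  induction l with
  | nil => rfl
  | cons g l ih =>
    rw [List.prod_cons, Perm.mul_apply, ih fun f hf => h f (List.mem_cons_of_mem _ hf)]
    exact h g List.mem_cons_self

open Equiv in
theorem Equiv.Perm.list_prod_apply_of_mem {α : Type*} {l : List (Perm α)}
    (hl : l.Pairwise Perm.Disjoint) {f : Perm α} (hf : f ∈ l) {x : α} (hx : f x ≠ x) :
    l.prod x = f x := by
  induction l with
  | nil => simp at hf
  | cons g l ih =>
    rw [List.pairwise_cons] at hl
    rw [List.prod_cons, Perm.mul_apply]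
    rcases List.mem_cons.1 hf with rfl | hf
    · rw [Perm.list_prod_apply_of_forall_fixed fun h hh => (hl.1 h hh x).resolve_left hx]
    · rw [ih hl.2 hf]
      exact (hl.1 f hf (f x)).resolve_right fun h => hx (f.injective h)

namespace IsClassTransposition

variable {τ σ : Equiv.Perm ℤ} {r₁ m₁ r₂ m₂ : ℤ}

theorem exists_eq_of_apply_ne (h : IsClassTransposition τ r₁ m₁ r₂ m₂) {x : ℤ} (hx : τ x ≠ x) :
    ∃ k, x = r₁ + m₁ * k ∨ x = r₂ + m₂ * k := by
  by_contra! hk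
  exact hx (h.2.2 x (fun k => (hk k).1) fun k => (hk k).2)

/-- A common point of the two classes has the same index in both. -/
theorem index_eq (h : IsClassTransposition τ r₁ m₁ r₂ m₂) (hm₁ : 0 < m₁) (hm₂ : 0 < m₂) {k l : ℤ}
    (hkl : r₁ + m₁ * k = r₂ + m₂ * l) : k = l := by
  have hτ : r₂ + m₂ * k = r₁ + m₁ * l := by rw [← h.1, hkl, h.2.1]
  have h0 : (m₁ + m₂) * (k - l) = 0 := by linear_combination hkl + hτ
  rcases mul_eq_zero.1 h0 with h0 | h0 <;> omega

/-- A point moved by a refined transposition has an index congruent to `i` modulo `n`,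
and is moved to the same place as by the original one. -/
theorem exists_index_of_refined_apply_ne {n i : ℤ} (h : IsClassTransposition τ r₁ m₁ r₂ m₂)
    (hσ : IsClassTransposition σ (i * m₁ + r₁) (n * m₁) (i * m₂ + r₂) (n * m₂))
    {x : ℤ} (hx : σ x ≠ x) :
    (∃ q, x = r₁ + m₁ * (i + n * q) ∨ x = r₂ + m₂ * (i + n * q)) ∧ σ x = τ x := by
  obtain ⟨q, rfl | rfl⟩ := hσ.exists_eq_of_apply_ne hx
  · have e : i * m₁ + r₁ + n * m₁ * q = r₁ + m₁ * (i + n * q) := by ring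
    refine ⟨⟨q, Or.inl e⟩, ?_⟩
    rw [hσ.1, e, h.1]
    ring
  · have e : i * m₂ + r₂ + n * m₂ * q = r₂ + m₂ * (i + n * q) := by ring
    refine ⟨⟨q, Or.inr e⟩, ?_⟩
    rw [hσ.2.1, e, h.2.1]
    ring

theorem refined_apply_eq {n i q : ℤ} (h : IsClassTransposition τ r₁ m₁ r₂ m₂)
    (hσ : IsClassTransposition σ (i * m₁ + r₁) (n * m₁) (i * m₂ + r₂) (n * m₂))
    {x : ℤ} (hx : x = r₁ + m₁ * (i + n * q) ∨ x = r₂ + m₂ * (i + n * q)) : σ x = τ x := by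
  rcases hx with rfl | rfl
  · rw [h.1, show r₁ + m₁ * (i + n * q) = i * m₁ + r₁ + n * m₁ * q by ring, hσ.1]
    ring
  · rw [h.2.1, show r₂ + m₂ * (i + n * q) = i * m₂ + r₂ + n * m₂ * q by ring, hσ.2.1]
    ring

end IsClassTransposition

/-- A class transposition `τ_{r₁(m₁), r₂(m₂)}` equals, for any positive
integer `n`, the product over `k = 0, …, n-1` of the class transpositions
`τ_{k m₁ + r₁ (n m₁), k m₂ + r₂ (n m₂)}`; moreover these `n` factors have pairwise
disjoint supports, hence pairwise commute. -/
theorem class_transposition_eq_prod_refined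
    (m₁ m₂ r₁ r₂ : ℤ) (hm₁ : 0 < m₁) (hm₂ : 0 < m₂)
    (hr₁ : 0 ≤ r₁) (hr₁' : r₁ < m₁) (hr₂ : 0 ≤ r₂) (hr₂' : r₂ < m₂)
    (τ : Equiv.Perm ℤ) (hτ : IsClassTransposition τ r₁ m₁ r₂ m₂)
    (n : ℕ) (hn : 0 < n) (τs : Fin n → Equiv.Perm ℤ)
    (hτs : ∀ k : Fin n, IsClassTransposition (τs k)
      (((k : ℕ) : ℤ) * m₁ + r₁) ((n : ℤ) * m₁) (((k : ℕ) : ℤ) * m₂ + r₂) ((n : ℤ) * m₂)) :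
    τ = (List.ofFn τs).prod ∧
    (∀ i j : Fin n, i ≠ j →
      Disjoint {x : ℤ | τs i x ≠ x} {x : ℤ | τs j x ≠ x}) ∧
    (∀ i j : Fin n, Commute (τs i) (τs j)) := by
  have hdisj : ∀ i j : Fin n, i ≠ j → (τs i).Disjoint (τs j) := by
    intro i j hij x
    by_contra! hx
    obtain ⟨⟨p, hp⟩, -⟩ := hτ.exists_index_of_refined_apply_ne (hτs i) hx.1
    obtain ⟨⟨q, hq⟩, -⟩ := hτ.exists_index_of_refined_apply_ne (hτs j) hx.2
    have key : (i : ℤ) + n * p = j + n * q := by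
      rcases hp with hp | hp <;> rcases hq with hq | hq
      · exact mul_left_cancel₀ hm₁.ne' (add_left_cancel (hp.symm.trans hq))
      · exact hτ.index_eq hm₁ hm₂ (hp.symm.trans hq)
      · exact (hτ.index_eq hm₁ hm₂ (hq.symm.trans hp)).symm
      · exact mul_left_cancel₀ hm₂.ne' (add_left_cancel (hp.symm.trans hq))
    have hmod := congrArg (· % (n : ℤ)) key
    simp only [Int.add_mul_emod_self_left] at hmod
    rw [Int.emod_eq_of_lt (by omega) (by omega), Int.emod_eq_of_lt (by omega) (by omega)] at hmod
    exact hij (Fin.ext (by exact_mod_cast hmod))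
  refine ⟨?_, fun i j hij => ?_, fun i j => ?_⟩
  · ext x
    by_cases hx : ∃ i, τs i x ≠ x
    · obtain ⟨i, hi⟩ := hx
      rw [Equiv.Perm.list_prod_apply_of_mem
        (List.pairwise_ofFn.2 fun i j hij => hdisj i j hij.ne) (List.mem_ofFn.2 ⟨i, rfl⟩) hi]
      exact (hτ.exists_index_of_refined_apply_ne (hτs i) hi).2.symm
    · push Not at hx
      rw [Equiv.Perm.list_prod_apply_of_forall_fixed (by simpa [List.mem_ofFn] using hx)]
      by_contra hne
      obtain ⟨k, hk⟩ := hτ.exists_eq_of_apply_ne hne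
      have hn' : (0 : ℤ) < n := by exact_mod_cast hn
      obtain ⟨i, hi⟩ := Int.eq_ofNat_of_zero_le (Int.emod_nonneg k hn'.ne')
      have hin : i < n := by
        have := Int.emod_lt_of_pos k hn'
        omega
      rw [← Int.emod_add_mul_ediv k n, hi] at hk
      exact hne ((hτ.refined_apply_eq (hτs ⟨i, hin⟩) hk).symm.trans (hx _))
  · exact Set.disjoint_left.2 fun x hi hj => (hdisj i j hij x).elim hi hj
  · rcases eq_or_ne i j with rfl | hij
    · exact Commute.refl _
    · exact (hdisj i j hij).commute
end

section
/- Let τ_{r_i(n_i), r̃_i(n_i)}, i = 1, …, m, be horizontal class transpositions (so 0 ≤ r_i < r̃_i < n_i for each i). Let N = lcm(n₁, …, n_m) and p_i = N / n_i. Then the order of the product τ_{r₁(n₁),r̃₁(n₁)} ⋯ τ_{r_m(n_m),r̃_m(n_m)} in the permutation group of ℤ equals the order, in the symmetric group on {0, 1, …, N − 1}, of the product over i = 1, …, m and k = 0, …, p_i − 1 of the transpositions (n_i k + r_i, n_i k + r̃_i). -/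
/-- The product of the disjoint transpositions `(a k, b k)`, `k < p`, exchanges `a k` and `b k`
for every `k < p` and fixes every other point. -/
theorem prod_swap_range_apply {α : Type*} [DecidableEq α] (a b : ℕ → α) (p : ℕ)
    (ha : ∀ k < p, ∀ l < p, a k = a l → k = l) (hb : ∀ k < p, ∀ l < p, b k = b l → k = l)
    (hab : ∀ k < p, ∀ l < p, a k ≠ b l) :
    (∀ k < p, (((List.range p).map fun k => Equiv.swap (a k) (b k)).prod) (a k) = b k) ∧
    (∀ k < p, (((List.range p).map fun k => Equiv.swap (a k) (b k)).prod) (b k) = a k) ∧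
    (∀ x, (∀ k < p, x ≠ a k) → (∀ k < p, x ≠ b k) →
      (((List.range p).map fun k => Equiv.swap (a k) (b k)).prod) x = x) := by
  induction p with
  | zero => simp
  | succ p ih =>
    obtain ⟨h₁, h₂, h₃⟩ := ih (fun k hk l hl => ha k (by omega) l (by omega))
      (fun k hk l hl => hb k (by omega) l (by omega))
      (fun k hk l hl => hab k (by omega) l (by omega))
    simp only [List.range_succ, List.map_append, List.map_cons, List.map_nil, List.prod_append,
      List.prod_cons, List.prod_nil, mul_one, Equiv.Perm.mul_apply]
    have fix_a : ∀ k < p, a p ≠ a k := fun k hk h =>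
      hk.ne' (ha p (by omega) k (by omega) h)
    have fix_b : ∀ k < p, b p ≠ b k := fun k hk h =>
      hk.ne' (hb p (by omega) k (by omega) h)
    refine ⟨fun k hk => ?_, fun k hk => ?_, fun x hxa hxb => ?_⟩
    · rcases Nat.lt_succ_iff_lt_or_eq.mp hk with hk' | rfl
      · rw [Equiv.swap_apply_of_ne_of_ne (fix_a k hk').symm (hab k hk p (by omega)), h₁ k hk']
      · rw [Equiv.swap_apply_left]
        exact h₃ _ (fun l hl => (hab l (by omega) k hk).symm) fix_b
    · rcases Nat.lt_succ_iff_lt_or_eq.mp hk with hk' | rfl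
      · rw [Equiv.swap_apply_of_ne_of_ne (hab p (by omega) k hk).symm (fix_b k hk').symm,
          h₂ k hk']
      · rw [Equiv.swap_apply_right]
        exact h₃ _ fix_a (fun l hl => hab k hk l (by omega))
    · rw [Equiv.swap_apply_of_ne_of_ne (hxa p (by omega)) (hxb p (by omega))]
      exact h₃ x (fun k hk => hxa k (by omega)) (fun k hk => hxb k (by omega))

/-- Natural numbers `n k + r` and `n l + s` with `r, s < n` and `k, l < p` that agree modulo `n p`
have the same quotient and remainder modulo `n`. -/
theorem eq_and_eq_of_natCast_zmod_eq {n p k l r s : ℕ} (hr : r < n) (hs : s < n)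
    (hk : k < p) (hl : l < p)
    (h : ((n * k + r : ℕ) : ZMod (n * p)) = ((n * l + s : ℕ) : ZMod (n * p))) :
    k = l ∧ r = s := by
  have bound : ∀ {j t : ℕ}, t < n → j < p → n * j + t < n * p := fun {j t} ht hj => by
    calc n * j + t < n * (j + 1) := by rw [mul_add_one]; omega
      _ ≤ n * p := Nat.mul_le_mul_left n hj
  have key := Nat.ModEq.eq_of_lt_of_lt ((ZMod.natCast_eq_natCast_iff _ _ _).mp h)
    (bound hr hk) (bound hs hl)
  have hn : 0 < n := by omega
  constructor
  · have := congrArg (· / n) key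
    simpa [Nat.mul_add_div hn, Nat.div_eq_of_lt hr, Nat.div_eq_of_lt hs] using this
  · have := congrArg (· % n) key
    simpa [Nat.mul_add_mod, Nat.mod_eq_of_lt hr, Nat.mod_eq_of_lt hs] using this

/-- A horizontal class transposition of modulus `n` preserves the quotient by `n`. -/
theorem IsClassTransposition.apply_ediv {τ : Equiv.Perm ℤ} {n r r' : ℕ}
    (hτ : IsClassTransposition τ r n r' n) (hr : r < n) (hr' : r' < n) (x : ℤ) :
    τ x / n = x / n := by
  have quot : ∀ {t : ℕ} (k : ℤ), t < n → ((t : ℤ) + n * k) / n = k := fun {t} k ht => by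
    rw [Int.add_mul_ediv_left _ _ (by omega), Int.ediv_eq_zero_of_lt (by omega) (by omega),
      zero_add]
  obtain ⟨h₁, h₂, h₃⟩ := hτ
  by_cases hx : ∃ k : ℤ, x = r + n * k
  · obtain ⟨k, rfl⟩ := hx
    rw [h₁, quot k hr, quot k hr']
  by_cases hx' : ∃ k : ℤ, x = r' + n * k
  · obtain ⟨k, rfl⟩ := hx'
    rw [h₂, quot k hr, quot k hr']
  push Not at hx hx'
  rw [h₃ x hx hx']

/-- Reduction modulo `n p` carries a horizontal class transposition of modulus `n` to a product
of `p` transpositions. -/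
theorem IsClassTransposition.intCast_apply {τ : Equiv.Perm ℤ} {n p r r' : ℕ}
    (hτ : IsClassTransposition τ r n r' n) (hrr' : r ≠ r') (hr : r < n) (hr' : r' < n)
    (hp : 0 < p) (x : ℤ) :
    ((τ x : ℤ) : ZMod (n * p)) =
      ((List.range p).map fun k => Equiv.swap ((n * k + r : ℕ) : ZMod (n * p))
        ((n * k + r' : ℕ) : ZMod (n * p))).prod (x : ZMod (n * p)) := by
  obtain ⟨s₁, s₂, s₃⟩ := prod_swap_range_apply
    (fun k => ((n * k + r : ℕ) : ZMod (n * p))) (fun k => ((n * k + r' : ℕ) : ZMod (n * p))) p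
    (fun k hk l hl h => (eq_and_eq_of_natCast_zmod_eq hr hr hk hl h).1)
    (fun k hk l hl h => (eq_and_eq_of_natCast_zmod_eq hr' hr' hk hl h).1)
    (fun k hk l hl h => hrr' (eq_and_eq_of_natCast_zmod_eq hr hr' hk hl h).2)
  have reduce : ∀ k : ℤ, ∃ j < p, ∀ t : ℕ,
      (((t : ℤ) + n * k : ℤ) : ZMod (n * p)) = ((n * j + t : ℕ) : ZMod (n * p)) := by
    intro k
    have hp' : (0 : ℤ) < p := by exact_mod_cast hp
    obtain ⟨j, hj⟩ := Int.eq_ofNat_of_zero_le (Int.emod_nonneg k hp'.ne')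
    refine ⟨j, by have := Int.emod_lt_of_pos k hp'; omega, fun t => ?_⟩
    rw [← Int.cast_natCast (n * j + t), ZMod.intCast_eq_intCast_iff_dvd_sub]
    refine ⟨-(k / p), ?_⟩
    have := Int.mul_ediv_add_emod k p
    push_cast
    rw [hj] at this
    linear_combination (n : ℤ) * this
  have lift : ∀ {k t : ℕ}, (x : ZMod (n * p)) = ((n * k + t : ℕ) : ZMod (n * p)) →
      ∃ l : ℤ, x = t + n * l := by
    intro k t h
    rw [← Int.cast_natCast (n * k + t), eq_comm, ZMod.intCast_eq_intCast_iff_dvd_sub] at h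
    obtain ⟨c, hc⟩ := h
    refine ⟨k + p * c, ?_⟩
    push_cast at hc
    linear_combination hc
  obtain ⟨h₁, h₂, h₃⟩ := hτ
  by_cases hx : ∃ k : ℤ, x = r + n * k
  · obtain ⟨k, rfl⟩ := hx
    obtain ⟨j, hj, h⟩ := reduce k
    rw [h₁, h, h, s₁ j hj]
  by_cases hx' : ∃ k : ℤ, x = r' + n * k
  · obtain ⟨k, rfl⟩ := hx'
    obtain ⟨j, hj, h⟩ := reduce k
    rw [h₂, h, h, s₂ j hj]
  rw [s₃ x (fun k _ h => hx (lift h)) (fun k _ h => hx' (lift h))]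
  push Not at hx hx'
  rw [h₃ x hx hx']

/-- If `f` semiconjugates each `σ i` to `ρ i`, it semiconjugates their products. -/
theorem semiconj_prod_ofFn {α β : Type*} (f : α → β) {m : ℕ} (σ : Fin m → Equiv.Perm α)
    (ρ : Fin m → Equiv.Perm β) (h : ∀ i, Function.Semiconj f (σ i) (ρ i)) :
    Function.Semiconj f (List.ofFn σ).prod (List.ofFn ρ).prod := by
  induction m with
  | zero => intro x; simp
  | succ m ih =>
    intro x
    simp only [List.ofFn_succ, List.prod_cons, Equiv.Perm.mul_apply]
    rw [(h 0).eq, (ih _ _ fun i => h i.succ).eq]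

/-- A permutation of `ℤ` that preserves the quotient by `N` and induces the permutation `ρ`
modulo `N` has the same order as `ρ`. -/
theorem orderOf_eq_of_semiconj_intCast {N : ℕ} {σ : Equiv.Perm ℤ} {ρ : Equiv.Perm (ZMod N)}
    (hρ : Function.Semiconj (fun x : ℤ => (x : ZMod N)) σ ρ)
    (hσ : Function.Semiconj (fun x : ℤ => x / N) σ (1 : Equiv.Perm ℤ)) :
    orderOf σ = orderOf ρ := by
  refine orderOf_eq_orderOf_iff.mpr fun d => ?_
  have cast_pow : ∀ x : ℤ, (((σ ^ d) x : ℤ) : ZMod N) = (ρ ^ d) x := fun x => by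
    simpa only [Equiv.Perm.iterate_eq_pow] using (hρ.iterate_right d).eq x
  have div_pow : ∀ x : ℤ, (σ ^ d) x / N = x / N := fun x => by
    simpa only [Equiv.Perm.iterate_eq_pow, one_pow, Equiv.Perm.one_apply] using
      (hσ.iterate_right d).eq x
  constructor
  · intro h
    ext y
    obtain ⟨x, rfl⟩ := ZMod.intCast_surjective y
    rw [← cast_pow, h]
    simp
  · intro h
    ext x
    have hmod := cast_pow x
    rw [h, Equiv.Perm.one_apply, ZMod.intCast_eq_intCast_iff'] at hmod
    rw [Equiv.Perm.one_apply, ← Int.mul_ediv_add_emod ((σ ^ d) x) N, div_pow, hmod,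
      Int.mul_ediv_add_emod]

/-- Let `τ_{rᵢ(nᵢ), r̃ᵢ(nᵢ)}`, `i = 1, …, m`, be horizontal class
transpositions (so `0 ≤ rᵢ < r̃ᵢ < nᵢ`). Let `N = lcm(n₁, …, n_m)` and `pᵢ = N / nᵢ`.
Then the order of the product `τ_{r₁(n₁),r̃₁(n₁)} ⋯ τ_{r_m(n_m),r̃_m(n_m)}` in the
permutation group of `ℤ` equals the order, in the symmetric group on `{0, 1, …, N-1}`
(realized as `ZMod N`), of the product over `i = 1, …, m` and `k = 0, …, pᵢ - 1` of the
transpositions `(nᵢ k + rᵢ, nᵢ k + r̃ᵢ)`. -/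
theorem order_prod_horizontal_class_transpositions
    (m : ℕ) (n r r' : Fin m → ℕ)
    (hrr' : ∀ i, r i < r' i) (hr'n : ∀ i, r' i < n i)
    (τ : Fin m → Equiv.Perm ℤ)
    (hτ : ∀ i, IsClassTransposition (τ i)
      ((r i : ℤ)) ((n i : ℤ)) ((r' i : ℤ)) ((n i : ℤ))) :
    orderOf (List.ofFn τ).prod =
      orderOf (List.ofFn (fun i : Fin m =>
        ((List.range (Finset.univ.lcm n / n i)).map (fun k =>
          Equiv.swap ((n i * k + r i : ℕ) : ZMod (Finset.univ.lcm n))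
            ((n i * k + r' i : ℕ) : ZMod (Finset.univ.lcm n)))).prod)).prod := by
  have hn : ∀ i, 0 < n i := fun i => (Nat.zero_le _).trans_lt (hr'n i)
  have hN : Finset.univ.lcm n ≠ 0 := by
    simpa [Finset.lcm_eq_zero_iff] using fun i => (hn i).ne'
  have hdvd : ∀ i, n i ∣ Finset.univ.lcm n := fun i => Finset.dvd_lcm (Finset.mem_univ i)
  generalize Finset.univ.lcm n = N at *
  refine orderOf_eq_of_semiconj_intCast (semiconj_prod_ofFn _ _ _ fun i x => ?_) ?_
  · obtain ⟨p, rfl⟩ := hdvd i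
    rw [Nat.mul_div_cancel_left p (hn i)]
    exact (hτ i).intCast_apply (hrr' i).ne ((hrr' i).trans (hr'n i)) (hr'n i)
      (Nat.pos_of_ne_zero (right_ne_zero_of_mul hN)) x
  · have h := semiconj_prod_ofFn (fun x : ℤ => x / N) τ (fun _ => 1) fun i x => by
      obtain ⟨p, rfl⟩ := hdvd i
      simp only [Nat.cast_mul, Equiv.Perm.one_apply]
      rw [← Int.ediv_ediv_of_nonneg (Int.natCast_nonneg _),
        ← Int.ediv_ediv_of_nonneg (Int.natCast_nonneg _),
        (hτ i).apply_ediv ((hrr' i).trans (hr'n i)) (hr'n i)]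
    simpa using h
end

section
/- Any product of finitely many horizontal class transpositions has finite order in the permutation group of ℤ. -/
/-- A class transposition of two residues modulo `n` preserves each block `[n k, n (k + 1))`. -/
theorem IsClassTransposition.ediv_apply {τ : Equiv.Perm ℤ} {n r r' : ℤ}
    (hτ : IsClassTransposition τ r n r' n) (hr0 : 0 ≤ r) (hrr' : r < r') (hr'n : r' < n) (x : ℤ) :
    τ x / n = x / n := by
  obtain ⟨h₁, h₂, h₃⟩ := hτ
  have hn : n ≠ 0 := by omega
  have hr : r / n = 0 := Int.ediv_eq_zero_of_lt hr0 (by omega)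
  have hr' : r' / n = 0 := Int.ediv_eq_zero_of_lt (by omega) hr'n
  by_cases hx : ∃ k : ℤ, x = r + n * k
  · obtain ⟨k, rfl⟩ := hx
    rw [h₁, Int.add_mul_ediv_left _ _ hn, Int.add_mul_ediv_left _ _ hn, hr, hr']
  by_cases hy : ∃ k : ℤ, x = r' + n * k
  · obtain ⟨k, rfl⟩ := hy
    rw [h₂, Int.add_mul_ediv_left _ _ hn, Int.add_mul_ediv_left _ _ hn, hr, hr']
  · rw [h₃ x (not_exists.mp hx) (not_exists.mp hy)]

/-- A permutation of `ℤ` preserving each block `[M k, M (k + 1))` has finite order. -/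
theorem isOfFinOrder_of_ediv_apply {σ : Equiv.Perm ℤ} {M : ℤ} (hM : 0 < M)
    (h : ∀ x, σ x / M = x / M) : IsOfFinOrder σ := by
  have hpow (k : ℕ) (x : ℤ) : (σ ^ k) x / M = x / M := by
    induction k with
    | zero => simp
    | succ k ih => rw [pow_succ', Equiv.Perm.mul_apply, h, ih]
  refine isOfFinOrder_iff_pow_eq_one.mpr ⟨M.toNat.factorial, Nat.factorial_pos _, ?_⟩
  ext x
  have hmaps : ∀ k ∈ Finset.range (M.toNat + 1),
      (σ ^ k) x ∈ Finset.Ico (M * (x / M)) (M * (x / M) + M) := by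
    intro k _
    have hdiv := Int.mul_ediv_add_emod ((σ ^ k) x) M
    rw [hpow] at hdiv
    have := Int.emod_nonneg ((σ ^ k) x) hM.ne'
    have := Int.emod_lt_of_pos ((σ ^ k) x) hM
    rw [Finset.mem_Ico]
    constructor <;> linarith
  obtain ⟨i, hi, j, hj, hij, heq⟩ :=
    Finset.exists_ne_map_eq_of_card_lt_of_maps_to (by simp) hmaps
  wlog hlt : i < j generalizing i j
  · exact this j hj i hi hij.symm heq.symm (by omega)
  have hfix : (σ ^ (j - i)) x = x := by
    apply (σ ^ i).injective
    rw [← Equiv.Perm.mul_apply, ← pow_add, Nat.add_sub_cancel' hlt.le, heq]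
  obtain ⟨c, hc⟩ : j - i ∣ M.toNat.factorial :=
    Nat.dvd_factorial (by omega) (by rw [Finset.mem_range] at hj; omega)
  rw [hc, pow_mul]
  exact Equiv.Perm.pow_apply_eq_self_of_apply_eq_self hfix c

/-- Any product of finitely many horizontal class transpositions has
finite order in the permutation group of `ℤ`. -/
theorem prod_horizontal_class_transpositions_isOfFinOrder
    (N : ℕ) (τ : Fin N → Equiv.Perm ℤ) (n r r' : Fin N → ℤ)
    (hr0 : ∀ i, 0 ≤ r i) (hrr' : ∀ i, r i < r' i) (hr'n : ∀ i, r' i < n i)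
    (hτ : ∀ i, IsClassTransposition (τ i) (r i) (n i) (r' i) (n i)) :
    IsOfFinOrder (List.ofFn τ).prod := by
  have hn (i : Fin N) : 0 < n i := by linarith [hr0 i, hrr' i, hr'n i]
  have hblock : ∀ σ ∈ List.ofFn τ, ∀ x, σ x / (∏ i, n i) = x / (∏ i, n i) := by
    intro σ hσ x
    obtain ⟨i, rfl⟩ := (List.mem_ofFn' τ σ).mp hσ
    obtain ⟨c, hc⟩ := Finset.dvd_prod_of_mem n (Finset.mem_univ i)
    rw [hc, ← Int.ediv_ediv_of_nonneg (hn i).le, ← Int.ediv_ediv_of_nonneg (hn i).le,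
      (hτ i).ediv_apply (hr0 i) (hrr' i) (hr'n i)]
  refine isOfFinOrder_of_ediv_apply (M := ∏ i, n i) (Finset.prod_pos fun i _ => hn i) ?_
  generalize List.ofFn τ = l at hblock
  induction l with
  | nil => simp
  | cons σ l ih =>
    intro x
    rw [List.prod_cons, Equiv.Perm.mul_apply, hblock σ (by simp),
      ih fun ρ hρ => hblock ρ (List.mem_cons_of_mem _ hρ)]
end

section
/- The product τ_{0(2),1(2)} · τ_{0(3),1(3)} has order 4 in the permutation group of ℤ, and the subgroup of Sym(ℤ) generated by the class transpositions τ_{0(2),1(2)} and τ_{0(3),1(3)} has exactly 8 elements (it is the dihedral group of order 8). -/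
namespace IsClassTransposition

/-- When the moduli agree, an integer in the first residue class is moved by `r₂ - r₁`. -/
theorem apply_of_emod_eq_left {τ : Equiv.Perm ℤ} {r₁ r₂ m : ℤ}
    (h : IsClassTransposition τ r₁ m r₂ m) {n : ℤ} (hn : n % m = r₁) : τ n = n + (r₂ - r₁) := by
  have key := h.1 (n / m)
  rw [← hn, Int.emod_add_mul_ediv] at key
  rw [key]
  linarith [Int.emod_add_mul_ediv n m]

theorem symm {τ : Equiv.Perm ℤ} {r₁ m₁ r₂ m₂ : ℤ} (h : IsClassTransposition τ r₁ m₁ r₂ m₂) :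
    IsClassTransposition τ r₂ m₂ r₁ m₁ :=
  ⟨h.2.1, h.1, fun n h₁ h₂ => h.2.2 n h₂ h₁⟩

theorem apply_zero_two_one_two {σ : Equiv.Perm ℤ} (h : IsClassTransposition σ 0 2 1 2) (n : ℤ) :
    σ n = if n % 2 = 0 then n + 1 else n - 1 := by
  split_ifs with h₀
  · simpa using h.apply_of_emod_eq_left h₀
  · simpa [sub_eq_add_neg] using h.symm.apply_of_emod_eq_left (n := n) (by lia)

theorem apply_zero_three_one_three {η : Equiv.Perm ℤ} (h : IsClassTransposition η 0 3 1 3)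
    (n : ℤ) : η n = if n % 3 = 0 then n + 1 else if n % 3 = 1 then n - 1 else n := by
  split_ifs with h₀ h₁
  · simpa using h.apply_of_emod_eq_left h₀
  · simpa [sub_eq_add_neg] using h.symm.apply_of_emod_eq_left h₁
  · exact h.2.2 n (by lia) (by lia)

end IsClassTransposition

namespace DihedralGroup

variable {G : Type*} [Group G] {a b : G} {n : ℕ}

theorem zpow_mul_eq_mul_zpow_neg (ha : a * a = 1) (hb : b * b = 1) (k : ℤ) :
    (a * b) ^ k * a = a * (a * b) ^ (-k) := by
  have hconj : a * (a * b) * a⁻¹ = (a * b)⁻¹ := by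
    rw [mul_inv_rev, inv_eq_of_mul_eq_one_left ha, inv_eq_of_mul_eq_one_left hb, ← mul_assoc, ha,
      one_mul]
  have h := conj_zpow (i := -k) (a := a) (b := a * b)
  rw [hconj, inv_zpow', neg_neg] at h
  rw [h, inv_mul_cancel_right]

theorem zpow_cast_eq {c : G} (hc : c ^ n = 1) {i : ZMod n} {k : ℤ} (h : i = (k : ZMod n)) :
    c ^ (i.cast : ℤ) = c ^ k := by
  rw [zpow_eq_zpow_iff_modEq]
  refine Int.ModEq.of_dvd (Int.natCast_dvd_natCast.2 (orderOf_dvd_of_pow_eq_one hc)) ?_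
  rw [← ZMod.intCast_eq_intCast_iff, ZMod.intCast_zmod_cast, h]

/-- The homomorphism from the dihedral group determined by two involutions whose product has order
dividing `n`. -/
def liftInvolutions (ha : a * a = 1) (hb : b * b = 1) (hab : (a * b) ^ n = 1) :
    DihedralGroup n →* G :=
  MonoidHom.mk'
    (fun
      | r i => (a * b) ^ (i.cast : ℤ)
      | sr i => a * (a * b) ^ (i.cast : ℤ))
    (by
      rintro (i | i) (j | j)
      · change (a * b) ^ ((i + j).cast : ℤ) = _
        rw [zpow_cast_eq hab (k := i.cast + j.cast) (by simp), zpow_add]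
      · change a * (a * b) ^ ((j - i).cast : ℤ) = (a * b) ^ (i.cast : ℤ) * (a * _)
        rw [zpow_cast_eq hab (k := -i.cast + j.cast) (by simp; ring), zpow_add, ← mul_assoc,
          ← mul_assoc, zpow_mul_eq_mul_zpow_neg ha hb]
      · change a * (a * b) ^ ((i + j).cast : ℤ) = a * _ * _
        rw [zpow_cast_eq hab (k := i.cast + j.cast) (by simp), zpow_add, mul_assoc]
      · change (a * b) ^ ((j - i).cast : ℤ) = a * (a * b) ^ (i.cast : ℤ) * (a * _)
        rw [zpow_cast_eq hab (k := -i.cast + j.cast) (by simp; ring), zpow_add, mul_assoc a,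
          ← mul_assoc _ a, zpow_mul_eq_mul_zpow_neg ha hb, ← mul_assoc, ← mul_assoc, ha, one_mul])

variable (ha : a * a = 1) (hb : b * b = 1) (hab : (a * b) ^ n = 1)

theorem liftInvolutions_r (i : ZMod n) :
    liftInvolutions ha hb hab (r i) = (a * b) ^ (i.cast : ℤ) := rfl

theorem liftInvolutions_sr (i : ZMod n) :
    liftInvolutions ha hb hab (sr i) = a * (a * b) ^ (i.cast : ℤ) := rfl

theorem range_liftInvolutions :
    (liftInvolutions ha hb hab).range = Subgroup.closure {a, b} := by
  apply le_antisymm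
  · have hac : a ∈ Subgroup.closure {a, b} := Subgroup.subset_closure (by simp)
    have hbc : b ∈ Subgroup.closure {a, b} := Subgroup.subset_closure (by simp)
    rintro _ ⟨i | i, rfl⟩
    · exact zpow_mem (mul_mem hac hbc) _
    · exact mul_mem hac (zpow_mem (mul_mem hac hbc) _)
  · rw [Subgroup.closure_le]
    rintro x (rfl | rfl)
    · refine ⟨sr 0, ?_⟩
      rw [liftInvolutions_sr, zpow_cast_eq hab (k := 0) (by simp), zpow_zero, mul_one]
    · refine ⟨sr 1, ?_⟩
      rw [liftInvolutions_sr, zpow_cast_eq hab (k := 1) (by simp), zpow_one, ← mul_assoc, ha,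
        one_mul]

theorem liftInvolutions_injective (ho : orderOf (a * b) = n) (hn : 2 < n) :
    Function.Injective (liftInvolutions ha hb hab) := by
  rw [injective_iff_map_eq_one]
  rintro (i | i) h
  · rw [liftInvolutions_r, ← orderOf_dvd_iff_zpow_eq_one, ho, ← ZMod.intCast_zmod_eq_zero_iff_dvd,
      ZMod.intCast_zmod_cast] at h
    rw [h, r_zero]
  · rw [liftInvolutions_sr] at h
    have hcomm : Commute (a * b) a := by
      have := ((Commute.refl (a * b)).zpow_right (i.cast : ℤ)).inv_right
      rwa [← eq_inv_of_mul_eq_one_left h] at this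
    have hinv := zpow_mul_eq_mul_zpow_neg ha hb 1
    rw [zpow_one, hcomm.eq, zpow_neg_one, mul_right_inj, eq_inv_iff_mul_eq_one, ← sq] at hinv
    have := Nat.le_of_dvd two_pos (orderOf_dvd_of_pow_eq_one hinv)
    lia

/-- Two involutions whose product has order `n > 2` generate a dihedral group of order `2 * n`. -/
theorem nonempty_closure_pair_mulEquiv {a b : G} (ha : a * a = 1) (hb : b * b = 1)
    (ho : orderOf (a * b) = n) (hn : 2 < n) :
    Nonempty (Subgroup.closure {a, b} ≃* DihedralGroup n) := by
  have hab : (a * b) ^ n = 1 := ho ▸ pow_orderOf_eq_one _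
  rw [← range_liftInvolutions ha hb hab]
  exact ⟨(MonoidHom.ofInjective (liftInvolutions_injective ha hb hab ho hn)).symm⟩

end DihedralGroup

/-- The product `τ_{0(2),1(2)} · τ_{0(3),1(3)}` has order 4 in the
permutation group of `ℤ`, and the subgroup of `Sym(ℤ)` generated by the class
transpositions `τ_{0(2),1(2)}` and `τ_{0(3),1(3)}` has exactly 8 elements
(it is the dihedral group of order 8). -/
theorem order_four_dihedral_eight (σ η : Equiv.Perm ℤ)
    (hσ : IsClassTransposition σ 0 2 1 2)
    (hη : IsClassTransposition η 0 3 1 3) :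
    orderOf (σ * η) = 4 ∧
    Nat.card (Subgroup.closure {σ, η} : Subgroup (Equiv.Perm ℤ)) = 8 ∧
    Nonempty ((Subgroup.closure {σ, η} : Subgroup (Equiv.Perm ℤ)) ≃* DihedralGroup 4) := by
  have hσ' := hσ.apply_zero_two_one_two
  have hη' := hη.apply_zero_three_one_three
  have hσσ : σ * σ = 1 := by
    ext n
    simp only [Equiv.Perm.mul_apply, Equiv.Perm.one_apply, hσ']
    grind
  have hηη : η * η = 1 := by
    ext n
    simp only [Equiv.Perm.mul_apply, Equiv.Perm.one_apply, hη']
    grind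
  have hsq (n : ℤ) : ((σ * η) ^ 2) n =
      if n % 6 = 2 then n + 3 else if n % 6 = 3 then n + 1 else
      if n % 6 = 4 then n - 1 else if n % 6 = 5 then n - 3 else n := by
    simp only [sq, Equiv.Perm.mul_apply, hη', hσ']
    have : n % 6 = 0 ∨ n % 6 = 1 ∨ n % 6 = 2 ∨ n % 6 = 3 ∨ n % 6 = 4 ∨ n % 6 = 5 := by lia
    rcases this with h | h | h | h | h | h <;> simp only [h] <;> grind
  have ho : orderOf (σ * η) = 4 := by
    refine orderOf_eq_prime_pow (p := 2) (n := 1) (fun h => ?_) ?_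
    · have := hsq 2
      rw [← pow_one 2, h] at this
      simp at this
    · ext n
      rw [show 2 ^ (1 + 1) = 2 + 2 from rfl, pow_add, Equiv.Perm.mul_apply, hsq, hsq,
        Equiv.Perm.one_apply]
      grind
  obtain ⟨e⟩ := DihedralGroup.nonempty_closure_pair_mulEquiv hσσ hηη ho (by norm_num)
  exact ⟨ho, by rw [Nat.card_congr e.toEquiv, DihedralGroup.nat_card], ⟨e⟩⟩
end

section
/- The product τ_{0(3),1(3)} · τ_{2(4),3(4)} has order 6 in the permutation group of ℤ, and the subgroup of Sym(ℤ) generated by the class transpositions τ_{0(3),1(3)} and τ_{2(4),3(4)} has exactly 12 elements (it is the dihedral group of order 12). -/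
theorem zpow_intCast_zmod {G : Type*} [Group G] {x : G} {n : ℕ} (hx : x ^ n = 1) (k : ℤ) :
    x ^ (((k : ZMod n).cast : ℤ)) = x ^ k := by
  rw [ZMod.coe_intCast]
  conv_rhs => rw [← Int.emod_add_mul_ediv k n, zpow_add, zpow_mul, zpow_natCast, hx, one_zpow,
    mul_one]

theorem zpow_mul_of_mul_mul_self {G : Type*} [Group G] {a b : G} (ha : a * a = 1)
    (hb : b * b = 1) (k : ℤ) : (a * b) ^ k * a = a * (a * b) ^ (-k) := by
  have ha' : a⁻¹ = a := inv_eq_of_mul_eq_one_left ha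
  have hb' : b⁻¹ = b := inv_eq_of_mul_eq_one_left hb
  have h : a * (a * b)⁻¹ * a⁻¹ = a * b := by
    rw [mul_inv_rev, ha', hb', mul_assoc, mul_assoc, ha, mul_one]
  have h' := conj_zpow (i := k) (a := a) (b := (a * b)⁻¹)
  rw [h] at h'
  rw [h', inv_zpow, zpow_neg, inv_mul_cancel_right]

/-- The homomorphism from a dihedral group determined by two involutions `a`, `b` with
`(a * b) ^ n = 1`. It sends the rotation `r 1` to `a * b` and the reflection `sr 0` to `a`. -/
def dihedralHom {G : Type*} [Group G] {a b : G} (ha : a * a = 1) (hb : b * b = 1) {n : ℕ}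
    (hn : (a * b) ^ n = 1) : DihedralGroup n →* G :=
  MonoidHom.mk'
    (fun g => match g with
      | .r i => (a * b) ^ (i.cast : ℤ)
      | .sr i => a * (a * b) ^ (i.cast : ℤ))
    (by
      rintro (i | i) (j | j) <;>
      obtain ⟨i, rfl⟩ := ZMod.intCast_surjective i <;>
      obtain ⟨j, rfl⟩ := ZMod.intCast_surjective j <;>
      simp only [DihedralGroup.r_mul_r, DihedralGroup.r_mul_sr, DihedralGroup.sr_mul_r,
        DihedralGroup.sr_mul_sr, ← Int.cast_add, ← Int.cast_sub, zpow_intCast_zmod hn]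
      · rw [zpow_add]
      · rw [← mul_assoc, zpow_mul_of_mul_mul_self ha hb, mul_assoc, ← zpow_add, neg_add_eq_sub]
      · rw [mul_assoc, zpow_add]
      · rw [mul_assoc, ← mul_assoc _ a, zpow_mul_of_mul_mul_self ha hb, mul_assoc, ← mul_assoc a a,
          ha, one_mul, ← zpow_add, neg_add_eq_sub])

theorem dihedralHom_r {G : Type*} [Group G] {a b : G} (ha : a * a = 1) (hb : b * b = 1) {n : ℕ}
    (hn : (a * b) ^ n = 1) (k : ℤ) : dihedralHom ha hb hn (.r (k : ZMod n)) = (a * b) ^ k :=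
  zpow_intCast_zmod hn k

theorem dihedralHom_sr {G : Type*} [Group G] {a b : G} (ha : a * a = 1) (hb : b * b = 1) {n : ℕ}
    (hn : (a * b) ^ n = 1) (k : ℤ) : dihedralHom ha hb hn (.sr (k : ZMod n)) = a * (a * b) ^ k :=
  congrArg (a * ·) (zpow_intCast_zmod hn k)

theorem dihedralHom_range {G : Type*} [Group G] {a b : G} (ha : a * a = 1) (hb : b * b = 1)
    {n : ℕ} (hn : (a * b) ^ n = 1) :
    (dihedralHom ha hb hn).range = Subgroup.closure {a, b} := by
  apply le_antisymm
  · have hac : a ∈ Subgroup.closure {a, b} := Subgroup.subset_closure (by simp)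
    have hbc : b ∈ Subgroup.closure {a, b} := Subgroup.subset_closure (by simp)
    rintro _ ⟨i | i, rfl⟩ <;> obtain ⟨k, rfl⟩ := ZMod.intCast_surjective i
    · rw [dihedralHom_r]
      exact zpow_mem (mul_mem hac hbc) k
    · rw [dihedralHom_sr]
      exact mul_mem hac (zpow_mem (mul_mem hac hbc) k)
  · rw [Subgroup.closure_le]
    rintro x (rfl | rfl)
    · exact ⟨.sr ((0 : ℤ) : ZMod n), by rw [dihedralHom_sr, zpow_zero, mul_one]⟩
    · exact ⟨.sr ((1 : ℤ) : ZMod n), by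
        rw [dihedralHom_sr, zpow_one, ← mul_assoc, ha, one_mul]⟩

theorem dihedralHom_injective {G : Type*} [Group G] {a b : G} (ha : a * a = 1) (hb : b * b = 1)
    {n : ℕ} (hn : orderOf (a * b) = n) (h2 : (a * b) ^ 2 ≠ 1) :
    Function.Injective (dihedralHom ha hb (hn ▸ pow_orderOf_eq_one (a * b))) := by
  rw [injective_iff_map_eq_one]
  rintro (i | i) h <;> obtain ⟨k, rfl⟩ := ZMod.intCast_surjective i
  · rw [dihedralHom_r, ← orderOf_dvd_iff_zpow_eq_one, hn] at h
    rw [(ZMod.intCast_zmod_eq_zero_iff_dvd k n).2 h, DihedralGroup.r_zero]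
  · rw [dihedralHom_sr] at h
    have ha' : a = (a * b) ^ (-k) := by rw [zpow_neg]; exact eq_inv_of_mul_eq_one_left h
    have hc : (a * b) ^ (1 : ℤ) * a = a * (a * b) ^ (1 : ℤ) := by
      generalize a * b = x at ha'
      rw [ha', ← zpow_add, ← zpow_add, add_comm]
    rw [zpow_mul_of_mul_mul_self ha hb, mul_right_inj, zpow_neg, zpow_one] at hc
    exact absurd (by rw [sq]; nth_rewrite 1 [← hc]; exact inv_mul_cancel _) h2

/-- Two involutions whose product has order `n`, not dividing 2, generate a dihedral group. -/
theorem nonempty_closure_mulEquiv_dihedralGroup {G : Type*} [Group G] {a b : G}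
    (ha : a * a = 1) (hb : b * b = 1) {n : ℕ} (hn : orderOf (a * b) = n)
    (h2 : (a * b) ^ 2 ≠ 1) : Nonempty (Subgroup.closure {a, b} ≃* DihedralGroup n) :=
  ⟨((MonoidHom.ofInjective (dihedralHom_injective ha hb hn h2)).trans
    (MulEquiv.subgroupCongr (dihedralHom_range ha hb _))).symm⟩

theorem IsClassTransposition.mul_self {τ : Equiv.Perm ℤ} {r₁ m₁ r₂ m₂ : ℤ}
    (h : IsClassTransposition τ r₁ m₁ r₂ m₂) : τ * τ = 1 := by
  obtain ⟨h₁, h₂, h₃⟩ := h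
  ext n
  rw [Equiv.Perm.mul_apply, Equiv.Perm.one_apply]
  by_cases hn₁ : ∃ k, n = r₁ + m₁ * k
  · obtain ⟨k, rfl⟩ := hn₁
    rw [h₁, h₂]
  by_cases hn₂ : ∃ k, n = r₂ + m₂ * k
  · obtain ⟨k, rfl⟩ := hn₂
    rw [h₂, h₁]
  push Not at hn₁ hn₂
  rw [h₃ n hn₁ hn₂, h₃ n hn₁ hn₂]

/-- The action of `τ_{0(3), 1(3)}` on residues modulo 12. -/
def sigmaResidue : Fin 12 → Fin 12 := ![1, 0, 2, 4, 3, 5, 7, 6, 8, 10, 9, 11]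

/-- The action of `τ_{2(4), 3(4)}` on residues modulo 12. -/
def etaResidue : Fin 12 → Fin 12 := ![0, 1, 3, 2, 4, 5, 7, 6, 8, 9, 11, 10]

theorem IsClassTransposition.apply_sigmaResidue {σ : Equiv.Perm ℤ}
    (h : IsClassTransposition σ 0 3 1 3) (k : ℤ) (i : Fin 12) :
    σ (12 * k + (i : ℕ)) = 12 * k + (sigmaResidue i : ℕ) := by
  obtain ⟨h₁, h₂, h₃⟩ := h
  have hr : ∀ i : Fin 12, ((i : ℕ) % 3 = 0 ∧ (sigmaResidue i : ℕ) = i + 1) ∨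
      ((i : ℕ) % 3 = 1 ∧ (sigmaResidue i : ℕ) + 1 = i) ∨
      ((i : ℕ) % 3 = 2 ∧ sigmaResidue i = i) := by decide
  rcases hr i with ⟨hi, e⟩ | ⟨hi, e⟩ | ⟨hi, e⟩
  · have := h₁ ((12 * k + (i : ℕ)) / 3)
    rwa [show 0 + 3 * ((12 * k + ((i : ℕ) : ℤ)) / 3) = 12 * k + (i : ℕ) by lia,
      show 1 + 3 * ((12 * k + ((i : ℕ) : ℤ)) / 3) = 12 * k + (sigmaResidue i : ℕ) by lia] at this
  · have := h₂ ((12 * k + (i : ℕ)) / 3)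
    rwa [show 1 + 3 * ((12 * k + ((i : ℕ) : ℤ)) / 3) = 12 * k + (i : ℕ) by lia,
      show 0 + 3 * ((12 * k + ((i : ℕ) : ℤ)) / 3) = 12 * k + (sigmaResidue i : ℕ) by lia] at this
  · rw [e]
    exact h₃ _ (fun j => by lia) fun j => by lia

theorem IsClassTransposition.apply_etaResidue {η : Equiv.Perm ℤ}
    (h : IsClassTransposition η 2 4 3 4) (k : ℤ) (i : Fin 12) :
    η (12 * k + (i : ℕ)) = 12 * k + (etaResidue i : ℕ) := by
  obtain ⟨h₁, h₂, h₃⟩ := h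
  have hr : ∀ i : Fin 12, ((i : ℕ) % 4 = 2 ∧ (etaResidue i : ℕ) = i + 1) ∨
      ((i : ℕ) % 4 = 3 ∧ (etaResidue i : ℕ) + 1 = i) ∨
      ((i : ℕ) % 4 < 2 ∧ etaResidue i = i) := by decide
  rcases hr i with ⟨hi, e⟩ | ⟨hi, e⟩ | ⟨hi, e⟩
  · have := h₁ ((12 * k + (i : ℕ)) / 4)
    rwa [show 2 + 4 * ((12 * k + ((i : ℕ) : ℤ)) / 4) = 12 * k + (i : ℕ) by lia,
      show 3 + 4 * ((12 * k + ((i : ℕ) : ℤ)) / 4) = 12 * k + (etaResidue i : ℕ) by lia] at this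
  · have := h₂ ((12 * k + (i : ℕ)) / 4)
    rwa [show 3 + 4 * ((12 * k + ((i : ℕ) : ℤ)) / 4) = 12 * k + (i : ℕ) by lia,
      show 2 + 4 * ((12 * k + ((i : ℕ) : ℤ)) / 4) = 12 * k + (etaResidue i : ℕ) by lia] at this
  · rw [e]
    exact h₃ _ (fun j => by lia) fun j => by lia

/-- The product `τ_{0(3),1(3)} · τ_{2(4),3(4)}` has order 6 in the
permutation group of `ℤ`, and the subgroup of `Sym(ℤ)` generated by the class
transpositions `τ_{0(3),1(3)}` and `τ_{2(4),3(4)}` has exactly 12 elements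
(it is the dihedral group of order 12). -/
theorem order_six_dihedral_twelve (σ η : Equiv.Perm ℤ)
    (hσ : IsClassTransposition σ 0 3 1 3)
    (hη : IsClassTransposition η 2 4 3 4) :
    orderOf (σ * η) = 6 ∧
    Nat.card (Subgroup.closure {σ, η} : Subgroup (Equiv.Perm ℤ)) = 12 ∧
    Nonempty ((Subgroup.closure {σ, η} : Subgroup (Equiv.Perm ℤ)) ≃* DihedralGroup 6) := by
  have hp (m : ℕ) (k : ℤ) (i : Fin 12) : ((σ * η) ^ m) (12 * k + (i : ℕ)) =
      12 * k + ((sigmaResidue ∘ etaResidue)^[m] i : ℕ) := by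
    induction m with
    | zero => rfl
    | succ m ih =>
      rw [pow_succ', Equiv.Perm.mul_apply, ih, Equiv.Perm.mul_apply, hη.apply_etaResidue,
        hσ.apply_sigmaResidue, Function.iterate_succ_apply']
      rfl
  have ne_one {m : ℕ} (i : Fin 12) (hi : (sigmaResidue ∘ etaResidue)^[m] i ≠ i) :
      (σ * η) ^ m ≠ 1 := by
    intro h
    have := hp m 0 i
    rw [h, Equiv.Perm.one_apply] at this
    exact hi (Fin.ext (by lia))
  have h₆ : (σ * η) ^ 6 = 1 := by
    ext n
    have hn := hp 6 (n / 12) ⟨(n % 12).toNat, by lia⟩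
    have hi : ∀ i, (sigmaResidue ∘ etaResidue)^[6] i = i := by decide
    rw [hi] at hn
    rwa [show 12 * (n / 12) + (((⟨(n % 12).toNat, by lia⟩ : Fin 12) : ℕ) : ℤ) = n by
      simp only; lia] at hn
  have h_sq : (σ * η) ^ 2 ≠ 1 := ne_one 2 (by decide)
  have h_cube : (σ * η) ^ 3 ≠ 1 := ne_one 0 (by decide)
  have ho : orderOf (σ * η) = 6 := by
    refine orderOf_eq_of_pow_and_pow_div_prime (by norm_num) h₆ fun p hp hd => ?_
    have : p ≤ 6 := Nat.le_of_dvd (by norm_num) hd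
    interval_cases p <;> first | exact h_sq | exact h_cube | (revert hp hd; norm_num)
  have e := nonempty_closure_mulEquiv_dihedralGroup hσ.mul_self hη.mul_self ho h_sq
  refine ⟨ho, ?_, e⟩
  rw [Nat.card_congr e.some.toEquiv, DihedralGroup.nat_card]
end

section
/- Let n, m be positive integers and r₁, r₂, r₃, r₄ integers with 0 ≤ r₁ < r₂ < n and 0 ≤ r₃ < r₄ < m. Then there do not exist integers x₁, x₂, x₃, x₄ satisfying the system: r₂ + n·x₁ = r₃ + m·x₂, r₄ + m·x₂ = r₁ + n·x₃, and r₂ + n·x₃ = r₃ + m·x₄. -/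
/-- A multiple of `m` lying strictly between `0` and `2 * m` is `m` itself. -/
lemma Int.eq_one_of_mul_pos_of_mul_lt_two_mul {m l : ℤ} (hm : 0 < m)
    (hpos : 0 < m * l) (hlt : m * l < 2 * m) : l = 1 := by
  have hl : 0 < l := pos_of_mul_pos_right hpos hm.le
  have hl' : l < 2 := by nlinarith
  omega

/-- For positive integers `n, m` and integers `r₁, r₂, r₃, r₄` with
`0 ≤ r₁ < r₂ < n` and `0 ≤ r₃ < r₄ < m`, there do not exist integers `x₁, x₂, x₃, x₄`
with `r₂ + n x₁ = r₃ + m x₂`, `r₄ + m x₂ = r₁ + n x₃` and `r₂ + n x₃ = r₃ + m x₄`. -/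
theorem no_forbidden_zigzag
    (n m r₁ r₂ r₃ r₄ : ℤ) (hn : 0 < n) (hm : 0 < m)
    (h₁ : 0 ≤ r₁) (h₂ : r₁ < r₂) (h₃ : r₂ < n)
    (h₄ : 0 ≤ r₃) (h₅ : r₃ < r₄) (h₆ : r₄ < m) :
    ¬ ∃ x₁ x₂ x₃ x₄ : ℤ,
      r₂ + n * x₁ = r₃ + m * x₂ ∧
      r₄ + m * x₂ = r₁ + n * x₃ ∧
      r₂ + n * x₃ = r₃ + m * x₄ := by
  rintro ⟨x₁, x₂, x₃, x₄, e₁, e₂, e₃⟩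
  have hk : n * (x₃ - x₁) = (r₂ - r₁) + (r₄ - r₃) := by linarith
  have hl : m * (x₄ - x₂) = (r₂ - r₁) + (r₄ - r₃) := by linarith
  rcases le_total n m with hnm | hmn
  · have hone : x₄ - x₂ = 1 :=
      Int.eq_one_of_mul_pos_of_mul_lt_two_mul hm (by linarith) (by linarith)
    rw [hone, mul_one] at hl
    have hdvd : n ∣ r₂ - r₃ :=
      ⟨(x₃ - x₁) * x₂ - x₁, by linear_combination e₁ + x₂ * hl - x₂ * hk⟩
    have := Int.le_of_dvd (by linarith) hdvd
    linarith
  · have hone : x₃ - x₁ = 1 :=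
      Int.eq_one_of_mul_pos_of_mul_lt_two_mul hn (by linarith) (by linarith)
    rw [hone, mul_one] at hk
    have hdvd : m ∣ r₄ - r₁ :=
      ⟨(x₄ - x₂) * x₃ - x₂, by linear_combination e₂ + x₃ * hk - x₃ * hl⟩
    have := Int.le_of_dvd (by linarith) hdvd
    linarith
end

section
/- Let n, m be positive integers and r₁, r₂, r₃, r₄ integers with 0 ≤ r₁ < r₂ < n and 0 ≤ r₃ < r₄ < m. Suppose there exist integers x₁, x₂, x₃, x₄ satisfying r₁ + n·x₁ = r₃ + m·x₂, r₄ + m·x₂ = r₁ + n·x₃, and r₂ + n·x₃ = r₃ + m·x₄. Then n divides r₄ − r₃, and there exists an integer x₅ such that r₄ + m·x₄ = r₂ + n·x₅ (namely x₅ = x₁ + 2(r₄ − r₃)/n). -/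
/-- For positive integers `n, m` and integers `r₁, r₂, r₃, r₄` with
`0 ≤ r₁ < r₂ < n` and `0 ≤ r₃ < r₄ < m`, if integers `x₁, x₂, x₃, x₄` satisfy
`r₁ + n x₁ = r₃ + m x₂`, `r₄ + m x₂ = r₁ + n x₃` and `r₂ + n x₃ = r₃ + m x₄`,
then `n ∣ r₄ - r₃` and the system extends: `r₄ + m x₄ = r₂ + n x₅` holds for
`x₅ = x₁ + 2 (r₄ - r₃) / n`. -/
theorem zigzag_extends
    (n m r₁ r₂ r₃ r₄ : ℤ) (hn : 0 < n) (hm : 0 < m)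
    (h₁ : 0 ≤ r₁) (h₂ : r₁ < r₂) (h₃ : r₂ < n)
    (h₄ : 0 ≤ r₃) (h₅ : r₃ < r₄) (h₆ : r₄ < m)
    (x₁ x₂ x₃ x₄ : ℤ)
    (e₁ : r₁ + n * x₁ = r₃ + m * x₂)
    (e₂ : r₄ + m * x₂ = r₁ + n * x₃)
    (e₃ : r₂ + n * x₃ = r₃ + m * x₄) :
    n ∣ (r₄ - r₃) ∧
    r₄ + m * x₄ = r₂ + n * (x₁ + 2 * ((r₄ - r₃) / n)) := by
  have hd : r₄ - r₃ = n * (x₃ - x₁) := by linear_combination e₁ + e₂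
  refine ⟨⟨x₃ - x₁, hd⟩, ?_⟩
  rw [hd, Int.mul_ediv_cancel_left _ hn.ne']
  linear_combination hd - e₃
end

section
/- Let σ = τ_{r₁(n),r₂(n)} and η = τ_{r₃(m),r₄(m)} be horizontal class transpositions, where 0 ≤ r₁ < r₂ < n and 0 ≤ r₃ < r₄ < m. Then the order of the product σ · η in the permutation group of ℤ belongs to the set {1, 2, 3, 4, 6, 12}. -/
section Involutions

variable {α : Type*} {a b : Equiv.Perm α}

theorem pow_twelve_apply_eq_of_pow {p : Equiv.Perm α} {x : α} {k : ℕ} (hk : k ∣ 12)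
    (h : (p ^ k) x = x) : (p ^ 12) x = x := by
  obtain ⟨l, hl⟩ := hk
  rw [hl, pow_mul]
  exact Equiv.Perm.pow_apply_eq_self_of_apply_eq_self h l

theorem mul_pow_apply_left_eq (ha : ∀ x, a (a x) = x) (hb : ∀ x, b (b x) = x) {x : α} (k : ℕ)
    (h : ((a * b) ^ k) (a x) = a x) : ((a * b) ^ k) x = x := by
  have ha' : a⁻¹ = a := inv_eq_of_mul_eq_one_left (Equiv.ext ha)
  have hb' : b⁻¹ = b := inv_eq_of_mul_eq_one_left (Equiv.ext hb)
  have key : a * (a * b) ^ k * a⁻¹ = ((a * b) ^ k)⁻¹ := by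
    rw [← conj_pow, ← inv_pow, mul_inv_rev, hb']
    congr 1
    ext y
    simp [ha, ha']
  rw [ha'] at key
  have h1 : (((a * b) ^ k)⁻¹) x = x := by
    rw [← key, Equiv.Perm.mul_apply, Equiv.Perm.mul_apply, h, ha]
  exact (Equiv.Perm.inv_eq_iff_eq.1 h1).symm

theorem mul_pow_apply_right_eq (ha : ∀ x, a (a x) = x) (hb : ∀ x, b (b x) = x) {x : α} (k : ℕ)
    (h : ((a * b) ^ k) (b x) = b x) : ((a * b) ^ k) x = x := by
  apply mul_pow_apply_left_eq ha hb
  have h1 : ((a * b) ^ k) (a (b (b x))) = a (b (b x)) := by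
    have := congrArg (fun q : Equiv.Perm α => q (b x)) (pow_mul_comm' (a * b) k)
    simpa only [Equiv.Perm.mul_apply, h] using this
  rwa [hb] at h1

/-- An alternating path with at most four vertices around the edge `{x, b x}`. -/
theorem mul_pow_twelve_apply_of_short (ha : ∀ x, a (a x) = x) (hb : ∀ x, b (b x) = x) {x : α}
    (h1 : a x = x ∨ b (a x) = a x) (h2 : a (b x) = b x ∨ b (a (b x)) = a (b x)) :
    ((a * b) ^ 12) x = x := by
  rcases h1 with h1 | h1 <;> rcases h2 with h2 | h2
  · exact pow_twelve_apply_eq_of_pow (k := 2) (by norm_num)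
      (by simp [pow_succ, hb, h1, h2])
  · exact pow_twelve_apply_eq_of_pow (k := 3) (by norm_num)
      (by simp [pow_succ, ha, hb, h1, h2])
  · exact pow_twelve_apply_eq_of_pow (k := 3) (by norm_num)
      (by simp [pow_succ, ha, hb, h1, h2])
  · exact pow_twelve_apply_eq_of_pow (k := 4) (by norm_num)
      (by simp [pow_succ, ha, hb, h1, h2])

theorem mul_pow_apply_eq_swap (ha : ∀ x, a (a x) = x) (hb : ∀ x, b (b x) = x) {x : α} (k : ℕ)
    (h : ((b * a) ^ k) x = x) : ((a * b) ^ k) x = x := by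
  have ha' : a⁻¹ = a := inv_eq_of_mul_eq_one_left (Equiv.ext ha)
  have hb' : b⁻¹ = b := inv_eq_of_mul_eq_one_left (Equiv.ext hb)
  have h1 : ((a * b) ^ k) = ((b * a) ^ k)⁻¹ := by rw [← inv_pow, mul_inv_rev, ha', hb']
  rw [h1, Equiv.Perm.inv_eq_iff_eq, h]

/-- It suffices to treat the points on an `a`-edge both of whose ends are moved by `b`. -/
theorem mul_pow_twelve_eq_one (ha : ∀ x, a (a x) = x) (hb : ∀ x, b (b x) = x)
    (h : ∀ x, a x ≠ x → b x ≠ x → b (a x) ≠ a x → ((a * b) ^ 12) x = x) :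
    (a * b) ^ 12 = 1 := by
  have moved : ∀ x, b x ≠ x → ((a * b) ^ 12) x = x := by
    intro x hx
    have hx' : b (b x) ≠ b x := fun h' => hx (b.injective h')
    by_cases h1 : a x = x ∨ b (a x) = a x
    · by_cases h2 : a (b x) = b x ∨ b (a (b x)) = a (b x)
      · exact mul_pow_twelve_apply_of_short ha hb h1 h2
      · rw [not_or] at h2
        exact mul_pow_apply_right_eq ha hb _ (h _ h2.1 hx' h2.2)
    · rw [not_or] at h1
      exact h x h1.1 hx h1.2
  ext x
  by_cases hx : b x = x
  · by_cases h1 : a x = x ∨ b (a x) = a x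
    · exact mul_pow_twelve_apply_of_short ha hb h1 (by rwa [hx])
    · rw [not_or] at h1
      exact mul_pow_apply_left_eq ha hb _ (moved _ h1.2)
  · exact moved x hx

end Involutions

namespace IsClassTransposition

variable {τ : Equiv.Perm ℤ} {r s n x : ℤ}

theorem apply_of_dvd_left (h : IsClassTransposition τ r n s n) (hx : n ∣ x - r) :
    τ x = x + (s - r) := by
  obtain ⟨k, hk⟩ := hx
  have := h.1 k
  rw [← hk] at this
  rw [show x = r + (x - r) by ring, this]
  lia

theorem apply_of_dvd_right (h : IsClassTransposition τ r n s n) (hx : n ∣ x - s) :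
    τ x = x - (s - r) := by
  obtain ⟨k, hk⟩ := hx
  have := h.2.1 k
  rw [← hk] at this
  rw [show x = s + (x - s) by ring, this]
  lia

theorem apply_of_not_dvd (h : IsClassTransposition τ r n s n) (h1 : ¬ n ∣ x - r)
    (h2 : ¬ n ∣ x - s) : τ x = x :=
  h.2.2 x (fun k hk => h1 ⟨k, by lia⟩) (fun k hk => h2 ⟨k, by lia⟩)

theorem dvd_or_dvd_of_ne (h : IsClassTransposition τ r n s n) (hx : τ x ≠ x) :
    n ∣ x - r ∨ n ∣ x - s := by
  by_contra! hc
  exact hx (h.apply_of_not_dvd hc.1 hc.2)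

theorem apply_apply (h : IsClassTransposition τ r n s n) (x : ℤ) : τ (τ x) = x := by
  by_cases h1 : n ∣ x - r
  · rw [h.apply_of_dvd_left h1, h.apply_of_dvd_right (by convert h1 using 1; ring)]
    ring
  · by_cases h2 : n ∣ x - s
    · rw [h.apply_of_dvd_right h2, h.apply_of_dvd_left (by convert h2 using 1; ring)]
      ring
    · rw [h.apply_of_not_dvd h1 h2, h.apply_of_not_dvd h1 h2]

end IsClassTransposition

theorem mul_pow_twelve_apply_of_interior {n m r₁ r₂ r₃ r₄ : ℤ}
    (h₁ : 0 ≤ r₁) (h₂ : r₁ < r₂) (h₃ : r₂ < n) (h₄ : 0 ≤ r₃) (h₅ : r₃ < r₄) (h₆ : r₄ < m)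
    {σ η : Equiv.Perm ℤ} (hσ : IsClassTransposition σ r₁ n r₂ n)
    (hη : IsClassTransposition η r₃ m r₄ m) (hnm : n ≤ m) {x : ℤ} (hx : n ∣ x - r₁)
    (hx1 : η x ≠ x) (hx2 : η (σ x) ≠ σ x) : ((σ * η) ^ 12) x = x := by
  have hσx := hσ.apply_of_dvd_left hx
  have small : ∀ k y : ℤ, k ∣ y → |y| < k → y = 0 := fun k y => Int.eq_zero_of_abs_lt_dvd
  have not_dvd_d : ¬ n ∣ r₂ - r₁ := fun h => by
    have := small _ _ h (abs_lt.2 ⟨by lia, by lia⟩); lia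
  have not_dvd_d' : ¬ m ∣ r₂ - r₁ := fun h => by
    have := small _ _ h (abs_lt.2 ⟨by lia, by lia⟩); lia
  have h2' := hη.dvd_or_dvd_of_ne hx2
  rw [hσx] at h2'
  rcases hη.dvd_or_dvd_of_ne hx1 with h3 | h3
  · have hde : r₂ - r₁ = r₄ - r₃ := by
      rcases h2' with h4 | h4
      · exact absurd (by convert Int.dvd_sub h4 h3 using 1; ring) not_dvd_d'
      · have := small m (r₂ - r₁ - (r₄ - r₃)) (by convert Int.dvd_sub h4 h3 using 1; ring)
          (abs_lt.2 ⟨by lia, by lia⟩)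
        lia
    refine pow_twelve_apply_eq_of_pow (k := 1) (by norm_num) ?_
    rw [pow_one, Equiv.Perm.mul_apply, hη.apply_of_dvd_left h3, ← hde, ← hσx, hσ.apply_apply]
  · have h4 : m ∣ x + (r₂ - r₁) - r₃ := by
      rcases h2' with h4 | h4
      · exact h4
      · exact absurd (by convert Int.dvd_sub h4 h3 using 1; ring) not_dvd_d'
    have hm : m = (r₂ - r₁) + (r₄ - r₃) := by
      have := small m (r₂ - r₁ + (r₄ - r₃) - m)
        (by convert Int.dvd_sub (Int.dvd_sub h4 h3) (Int.dvd_refl m) using 1; ring)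
        (abs_lt.2 ⟨by lia, by lia⟩)
      lia
    have hηx := hη.apply_of_dvd_right h3
    have hησx : η (σ x) = x + m := by
      rw [hσx, hη.apply_of_dvd_left h4]; lia
    have not_dvd_m : ¬ n ∣ m := by
      intro hd
      have h5 : n ∣ r₃ - r₂ := by
        convert Int.dvd_sub hx (hd.trans h4) using 1; ring
      obtain ⟨c, hc⟩ := h5
      obtain ⟨q, hq⟩ := hd
      have hc0 : 0 ≤ c := by
        by_contra! hneg
        nlinarith
      nlinarith
    by_cases he : n ∣ r₄ - r₃
    · have hne : r₂ - r₁ ≠ r₄ - r₃ := fun h => not_dvd_d (h ▸ he)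
      have not_dvd_sub : ¬ m ∣ (r₂ - r₁) - (r₄ - r₃) := fun h => by
        have := small _ _ h (abs_lt.2 ⟨by lia, by lia⟩); lia
      have e1 : σ (η x) = x - (r₄ - r₃) + (r₂ - r₁) := by
        rw [hηx]
        exact hσ.apply_of_dvd_left (by convert Int.dvd_sub hx he using 1; ring)
      have e2 : σ (η (σ x)) = x + (r₄ - r₃) := by
        rw [hησx, hσ.apply_of_dvd_right]
        · lia
        · convert Int.dvd_add hx he using 1; lia
      have f1 : η (σ (η x)) = σ (η x) := by
        rw [e1]
        refine hη.apply_of_not_dvd (fun h => not_dvd_d' ?_) (fun h => not_dvd_sub ?_)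
        · convert Int.dvd_sub h h3 using 1; ring
        · convert Int.dvd_sub h h3 using 1; ring
      have f2 : η (σ (η (σ x))) = σ (η (σ x)) := by
        rw [e2]
        refine hη.apply_of_not_dvd (fun h => not_dvd_sub ?_) (fun h => not_dvd_d' ?_)
        · convert Int.dvd_sub h4 h using 1; ring
        · convert Int.dvd_sub h4 h using 1; ring
      exact pow_twelve_apply_eq_of_pow (k := 6) (by norm_num)
        (by simp [pow_succ, hσ.apply_apply, hη.apply_apply, f1, f2])
    · refine mul_pow_apply_eq_swap hσ.apply_apply hη.apply_apply _
        (mul_pow_twelve_apply_of_short hη.apply_apply hσ.apply_apply (Or.inr ?_) (Or.inr ?_))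
      · rw [hηx]
        refine hσ.apply_of_not_dvd (fun h => he ?_) (fun h => not_dvd_m ?_)
        · convert Int.dvd_sub hx h using 1; ring
        · convert Int.dvd_sub hx h using 1; lia
      · rw [hησx]
        refine hσ.apply_of_not_dvd (fun h => not_dvd_m ?_) (fun h => he ?_)
        · convert Int.dvd_sub h hx using 1; ring
        · convert Int.dvd_sub h hx using 1; lia

theorem mul_pow_twelve_eq_one_of_le {n m r₁ r₂ r₃ r₄ : ℤ}
    (h₁ : 0 ≤ r₁) (h₂ : r₁ < r₂) (h₃ : r₂ < n) (h₄ : 0 ≤ r₃) (h₅ : r₃ < r₄) (h₆ : r₄ < m)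
    {σ η : Equiv.Perm ℤ} (hσ : IsClassTransposition σ r₁ n r₂ n)
    (hη : IsClassTransposition η r₃ m r₄ m) (hnm : n ≤ m) : (σ * η) ^ 12 = 1 := by
  refine mul_pow_twelve_eq_one hσ.apply_apply hη.apply_apply fun x hx hx1 hx2 => ?_
  rcases hσ.dvd_or_dvd_of_ne hx with h | h
  · exact mul_pow_twelve_apply_of_interior h₁ h₂ h₃ h₄ h₅ h₆ hσ hη hnm h hx1 hx2
  · apply mul_pow_apply_left_eq hσ.apply_apply hη.apply_apply
    refine mul_pow_twelve_apply_of_interior h₁ h₂ h₃ h₄ h₅ h₆ hσ hη hnm ?_ hx2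
      (by rwa [hσ.apply_apply])
    rw [hσ.apply_of_dvd_right h]
    convert h using 1; ring

/-- For horizontal class transpositions `σ = τ_{r₁(n),r₂(n)}` and
`η = τ_{r₃(m),r₄(m)}` with `0 ≤ r₁ < r₂ < n` and `0 ≤ r₃ < r₄ < m`, the order of
`σ · η` in the permutation group of `ℤ` belongs to `{1, 2, 3, 4, 6, 12}`. -/
theorem order_prod_two_horizontal_mem
    (n m r₁ r₂ r₃ r₄ : ℤ)
    (h₁ : 0 ≤ r₁) (h₂ : r₁ < r₂) (h₃ : r₂ < n)
    (h₄ : 0 ≤ r₃) (h₅ : r₃ < r₄) (h₆ : r₄ < m)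
    (σ η : Equiv.Perm ℤ)
    (hσ : IsClassTransposition σ r₁ n r₂ n)
    (hη : IsClassTransposition η r₃ m r₄ m) :
    orderOf (σ * η) ∈ ({1, 2, 3, 4, 6, 12} : Set ℕ) := by
  have key : (σ * η) ^ 12 = 1 := by
    rcases le_total n m with h | h
    · exact mul_pow_twelve_eq_one_of_le h₁ h₂ h₃ h₄ h₅ h₆ hσ hη h
    · ext x
      refine mul_pow_apply_eq_swap hσ.apply_apply hη.apply_apply _ ?_
      rw [mul_pow_twelve_eq_one_of_le h₄ h₅ h₆ h₁ h₂ h₃ hη hσ h, Equiv.Perm.one_apply]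
  have hd : orderOf (σ * η) ∈ Nat.divisors 12 :=
    Nat.mem_divisors.2 ⟨orderOf_dvd_of_pow_eq_one key, by norm_num⟩
  have hdiv : Nat.divisors 12 = {1, 2, 3, 4, 6, 12} := by decide
  rw [hdiv] at hd
  simpa using hd
end

section
/- In the symmetric group on the six symbols {0, 1, 2, 3, 4, 5}, the subgroup G generated by the four permutations a = (0 1)(2 3)(4 5), b = (0 1)(3 4), c = (0 2)(3 5), and d = (1 2)(4 5) is isomorphic to the symmetric group S₅ (in particular |G| = 120), and G acts transitively on {0, 1, 2, 3, 4, 5}; hence G yields a non-standard (point-transitive) embedding of S₅ into S₆. -/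
open Equiv

/-- The subgroup of pairs `(g, σ)` such that conjugation by `g` permutes the family `m` in the
way prescribed by `σ`. -/
def conjPairs {G ι : Type*} [Group G] (m : ι → G) : Subgroup (G × Perm ι) where
  carrier := {p | ∀ i, p.1 * m i * p.1⁻¹ = m (p.2 i)}
  one_mem' i := by simp
  mul_mem' {p q} hp hq i := by
    have h := hp (q.2 i)
    rw [← hq i] at h
    simpa [mul_assoc] using h
  inv_mem' {p} hp i := by
    have h := hp (p.2⁻¹ i)
    rw [Perm.inv_def, apply_symm_apply, ← Perm.inv_def] at h
    simp only [Prod.fst_inv, Prod.snd_inv, ← h]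
    group

theorem mem_conjPairs {G ι : Type*} [Group G] {m : ι → G} {p : G × Perm ι} :
    p ∈ conjPairs m ↔ ∀ i, p.1 * m i * p.1⁻¹ = m (p.2 i) :=
  Iff.rfl

/-- If `m` is injective, a pair in `conjPairs m` is determined by its first component. -/
theorem eq_one_of_one_mem_conjPairs {G ι : Type*} [Group G] {m : ι → G}
    (hm : Function.Injective m) {σ : Perm ι} (h : (1, σ) ∈ conjPairs m) : σ = 1 := by
  ext i
  have := mem_conjPairs.1 h i
  simp only [one_mul, inv_one, mul_one] at this
  exact (hm this).symm

/-- A subgroup of a product that meets both factors trivially is the graph of an isomorphism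
between its two projections. -/
theorem nonempty_map_fst_mulEquiv_map_snd {G H : Type*} [Group G] [Group H]
    (C : Subgroup (G × H)) (h₁ : ∀ y, (1, y) ∈ C → y = 1) (h₂ : ∀ x, (x, 1) ∈ C → x = 1) :
    Nonempty (C.map (MonoidHom.fst G H) ≃* C.map (MonoidHom.snd G H)) := by
  have i₁ : Function.Injective ((MonoidHom.fst G H).comp C.subtype) := by
    rw [injective_iff_map_eq_one]
    rintro ⟨⟨x, y⟩, hxy⟩ rfl
    simp [h₁ y hxy]
  have i₂ : Function.Injective ((MonoidHom.snd G H).comp C.subtype) := by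
    rw [injective_iff_map_eq_one]
    rintro ⟨⟨x, y⟩, hxy⟩ rfl
    simp [h₂ x hxy]
  have r₁ : ((MonoidHom.fst G H).comp C.subtype).range = C.map (MonoidHom.fst G H) := by
    rw [MonoidHom.range_comp, Subgroup.range_subtype]
  have r₂ : ((MonoidHom.snd G H).comp C.subtype).range = C.map (MonoidHom.snd G H) := by
    rw [MonoidHom.range_comp, Subgroup.range_subtype]
  exact ⟨(MulEquiv.subgroupCongr r₁).symm.trans ((MonoidHom.ofInjective i₁).symm.trans
    ((MonoidHom.ofInjective i₂).trans (MulEquiv.subgroupCongr r₂)))⟩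

/-- A synthematic total: five fixed-point-free involutions of six points whose fifteen
transpositions are pairwise distinct. -/
def synthematicTotal : Fin 5 → Perm (Fin 6) :=
  ![swap 0 1 * swap 2 5 * swap 3 4, swap 0 2 * swap 1 4 * swap 3 5,
    swap 0 3 * swap 1 2 * swap 4 5, swap 0 4 * swap 1 5 * swap 2 3,
    swap 0 5 * swap 1 3 * swap 2 4]

theorem synthematicTotal_injective : Function.Injective synthematicTotal := by
  decide

/-- The synthemes of a total have trivial common centralizer. -/
theorem eq_one_of_mem_conjPairs_synthematicTotal {g : Perm (Fin 6)}
    (h : (g, 1) ∈ conjPairs synthematicTotal) : g = 1 := by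
  have key : ∀ i x, g (synthematicTotal i x) = synthematicTotal i (g x) := fun i x => by
    have := mem_conjPairs.1 h i
    rw [mul_inv_eq_iff_eq_mul] at this
    exact congrArg (· x) this
  have h₀ : ∀ y : Fin 6, (∀ i j k,
      synthematicTotal i 0 = synthematicTotal j (synthematicTotal k 0) →
      synthematicTotal i y = synthematicTotal j (synthematicTotal k y)) → y = 0 := by
    decide
  have hg : g 0 = 0 := h₀ _ fun i j k e => by rw [← key, ← key, ← key, e]
  have hx : ∀ x : Fin 6, x = 0 ∨ ∃ i, x = synthematicTotal i 0 := by decide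
  refine Equiv.ext fun x => ?_
  obtain rfl | ⟨i, rfl⟩ := hx x
  · exact hg
  · rw [key, hg, Perm.one_apply]

theorem closure_perm_fin_five_eq_top :
    Subgroup.closure {swap 1 4, swap 1 2 * swap 3 4, swap 0 2 * swap 3 4,
      swap 0 1 * swap 3 4} = (⊤ : Subgroup (Perm (Fin 5))) := by
  set S : Set (Perm (Fin 5)) := {swap 1 4, swap 1 2 * swap 3 4, swap 0 2 * swap 3 4,
    swap 0 1 * swap 3 4}
  have ha : swap 1 4 ∈ Subgroup.closure S := Subgroup.subset_closure (by simp [S])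
  have hb : swap 1 2 * swap 3 4 ∈ Subgroup.closure S := Subgroup.subset_closure (by simp [S])
  have hc : swap 0 2 * swap 3 4 ∈ Subgroup.closure S := Subgroup.subset_closure (by simp [S])
  have hs := mul_mem (mul_mem (mul_mem ha hb) ha) hc
  have hcycle : (swap 1 4 * (swap 1 2 * swap 3 4) * swap 1 4 * (swap 0 2 * swap 3 4) :
      Perm (Fin 5)) = List.formPerm [0, 4, 1, 3, 2] := by decide
  rw [hcycle] at hs
  rw [eq_top_iff, ← Perm.closure_prime_cycle_swap (σ := List.formPerm [0, 4, 1, 3, 2])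
    (τ := swap (1 : Fin 5) 4) (by simpa using Nat.prime_five)
    (List.isCycle_formPerm (by decide) (by decide)) (by decide) ⟨1, 4, by decide, rfl⟩,
    Subgroup.closure_le]
  rintro _ (rfl | rfl)
  exacts [hs, ha]


/-- In the symmetric group on `{0, 1, 2, 3, 4, 5}`, the subgroup `G`
generated by `a = (0 1)(2 3)(4 5)`, `b = (0 1)(3 4)`, `c = (0 2)(3 5)` and
`d = (1 2)(4 5)` is isomorphic to `S₅` (in particular `|G| = 120`) and acts
transitively on the six symbols; hence `G` is a non-standard (point-transitive)
embedding of `S₅` into `S₆`. -/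
theorem nonstandard_S5_in_S6 (a b c d : Equiv.Perm (Fin 6))
    (ha : a = Equiv.swap 0 1 * Equiv.swap 2 3 * Equiv.swap 4 5)
    (hb : b = Equiv.swap 0 1 * Equiv.swap 3 4)
    (hc : c = Equiv.swap 0 2 * Equiv.swap 3 5)
    (hd : d = Equiv.swap 1 2 * Equiv.swap 4 5) :
    Nonempty ((Subgroup.closure {a, b, c, d} : Subgroup (Equiv.Perm (Fin 6))) ≃*
      Equiv.Perm (Fin 5)) ∧
    Nat.card (Subgroup.closure {a, b, c, d} : Subgroup (Equiv.Perm (Fin 6))) = 120 ∧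
    ∀ x y : Fin 6, ∃ g ∈ Subgroup.closure {a, b, c, d}, g x = y := by
  subst ha hb hc hd
  set C : Subgroup (Perm (Fin 6) × Perm (Fin 5)) := Subgroup.closure
    {(swap 0 1 * swap 2 3 * swap 4 5, swap 1 4),
      (swap 0 1 * swap 3 4, swap 1 2 * swap 3 4),
      (swap 0 2 * swap 3 5, swap 0 2 * swap 3 4),
      (swap 1 2 * swap 4 5, swap 0 1 * swap 3 4)} with hC
  have hCK : C ≤ conjPairs synthematicTotal := by
    rw [hC, Subgroup.closure_le]
    rintro _ (rfl | rfl | rfl | rfl) <;> exact mem_conjPairs.2 (by decide)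
  obtain ⟨e⟩ := nonempty_map_fst_mulEquiv_map_snd C
    (fun _ h => eq_one_of_one_mem_conjPairs synthematicTotal_injective (hCK h))
    (fun _ h => eq_one_of_mem_conjPairs_synthematicTotal (hCK h))
  have h₁ : C.map (MonoidHom.fst _ _) = Subgroup.closure {swap 0 1 * swap 2 3 * swap 4 5,
      swap 0 1 * swap 3 4, swap 0 2 * swap 3 5, swap 1 2 * swap 4 5} := by
    simp only [hC, MonoidHom.map_closure, Set.image_insert_eq, Set.image_singleton,
      MonoidHom.coe_fst]
  have h₂ : C.map (MonoidHom.snd _ _) = ⊤ := by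
    rw [← closure_perm_fin_five_eq_top]
    simp only [hC, MonoidHom.map_closure, Set.image_insert_eq, Set.image_singleton,
      MonoidHom.coe_snd]
  have E := (MulEquiv.subgroupCongr h₁).symm.trans
    (e.trans ((MulEquiv.subgroupCongr h₂).trans Subgroup.topEquiv))
  refine ⟨⟨E⟩, ?_, ?_⟩
  · rw [Nat.card_congr E.toEquiv, Nat.card_perm, Nat.card_fin]
    rfl
  · set S : Set (Perm (Fin 6)) := {swap 0 1 * swap 2 3 * swap 4 5, swap 0 1 * swap 3 4,
      swap 0 2 * swap 3 5, swap 1 2 * swap 4 5}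
    have ha : swap 0 1 * swap 2 3 * swap 4 5 ∈ Subgroup.closure S :=
      Subgroup.subset_closure (by simp [S])
    have hb : swap 0 1 * swap 3 4 ∈ Subgroup.closure S := Subgroup.subset_closure (by simp [S])
    have hc : swap 0 2 * swap 3 5 ∈ Subgroup.closure S := Subgroup.subset_closure (by simp [S])
    have from_zero : ∀ x : Fin 6, ∃ g ∈ Subgroup.closure S, g 0 = x := by
      intro x
      fin_cases x
      · exact ⟨1, one_mem _, rfl⟩
      · exact ⟨_, ha, by decide⟩
      · exact ⟨_, hc, by decide⟩
      · exact ⟨_, mul_mem ha hc, by decide⟩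
      · exact ⟨_, mul_mem hb (mul_mem ha hc), by decide⟩
      · exact ⟨_, mul_mem hc (mul_mem ha hc), by decide⟩
    intro x y
    obtain ⟨g, hg, rfl⟩ := from_zero x
    obtain ⟨k, hk, rfl⟩ := from_zero y
    exact ⟨k * g⁻¹, mul_mem hk (inv_mem hg), by simp⟩
end

section
/- The subgroup of Sym(ℤ) generated by the four class transpositions τ_{0(2),1(2)}, τ_{0(3),1(3)}, τ_{0(3),2(3)}, and τ_{1(3),2(3)} is isomorphic to the symmetric group S₅; in particular it has exactly 120 elements. -/
open Equiv

/-- A class transposition with equal moduli translates its two residue classes onto each other. -/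
theorem IsClassTransposition.apply_eq_ite {τ : Perm ℤ} {r₁ r₂ m : ℤ}
    (h : IsClassTransposition τ r₁ m r₂ m) (n : ℤ) :
    τ n = if m ∣ n - r₁ then n + (r₂ - r₁) else if m ∣ n - r₂ then n + (r₁ - r₂) else n := by
  split_ifs with h₁ h₂
  · obtain ⟨k, hk⟩ := h₁
    obtain rfl : n = r₁ + m * k := by linarith
    rw [h.1]
    ring
  · obtain ⟨k, hk⟩ := h₂
    obtain rfl : n = r₂ + m * k := by linarith
    rw [h.2.1]
    ring
  · exact h.2.2 n (fun k hk ↦ h₁ ⟨k, by linarith⟩) (fun k hk ↦ h₂ ⟨k, by linarith⟩)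

/-- A permutation of `Fin n` acts on `ℤ` by permuting each block `{nk, …, nk + n - 1}`. -/
def blockPerm (n : ℕ) [NeZero n] : Perm (Fin n) →* Perm ℤ where
  toFun σ := (Int.divModEquiv n).trans
    ((prodCongrRight fun _ ↦ σ).trans (Int.divModEquiv n).symm)
  map_one' := by ext x; exact (Int.divModEquiv n).symm_apply_apply x
  map_mul' σ τ := by
    ext
    simp only [Perm.mul_apply, trans_apply, apply_symm_apply]
    rfl

theorem blockPerm_divModEquiv_symm (n : ℕ) [NeZero n] (σ : Perm (Fin n)) (k : ℤ) (r : Fin n) :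
    blockPerm n σ ((Int.divModEquiv n).symm (k, r)) = (Int.divModEquiv n).symm (k, σ r) := by
  simp [blockPerm, -Int.divModEquiv_apply, -Int.divModEquiv_symm_apply]

theorem blockPerm_injective (n : ℕ) [NeZero n] : Function.Injective (blockPerm n) := by
  intro σ τ h
  ext1 r
  have := congr($h ((Int.divModEquiv n).symm (0, r)))
  rw [blockPerm_divModEquiv_symm, blockPerm_divModEquiv_symm] at this
  simpa using (Int.divModEquiv n).symm.injective this

/-- It suffices to check on residues that a permutation acts blockwise. -/
theorem eq_blockPerm {n : ℕ} [NeZero n] {τ : Perm ℤ} {σ : Perm (Fin n)}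
    (h : ∀ (k : ℤ) (r : Fin n), τ (k * n + (r : ℕ)) = k * n + (σ r : ℕ)) :
    τ = blockPerm n σ := by
  ext x
  obtain ⟨⟨k, r⟩, rfl⟩ := (Int.divModEquiv n).symm.surjective x
  rw [blockPerm_divModEquiv_symm]
  simpa using h k r

/-- The permutations of residues modulo `6` induced by the four class transpositions. -/
def residuePerm : Fin 4 → Perm (Fin 6) :=
  ![swap 0 1 * swap 2 3 * swap 4 5, swap 0 1 * swap 3 4, swap 0 2 * swap 3 5, swap 1 2 * swap 4 5]

/-- A synthematic total: five fixed-point-free involutions of `Fin 6`, no two of which agree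
at a point. -/
def syntheme : Fin 5 → Perm (Fin 6) :=
  ![swap 0 1 * swap 2 5 * swap 3 4, swap 0 2 * swap 1 4 * swap 3 5,
    swap 0 3 * swap 1 2 * swap 4 5, swap 0 4 * swap 1 5 * swap 2 3,
    swap 0 5 * swap 1 3 * swap 2 4]

/-- The permutations of the five synthemes induced by `residuePerm` through conjugation. -/
def synthemePerm : Fin 4 → Perm (Fin 5) :=
  ![swap 1 4, swap 1 2 * swap 3 4, swap 0 2 * swap 3 4, swap 0 1 * swap 3 4]

/-- The pairs `(σ, π)` such that conjugation by `σ` permutes the family `s` according to `π`. -/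
def conjGraph {G ι : Type*} [Group G] (s : ι → G) : Subgroup (G × Perm ι) where
  carrier := {x | ∀ i, x.1 * s i = s (x.2 i) * x.1}
  one_mem' i := by simp
  mul_mem' {x y} hx hy i := by
    simp only [Prod.fst_mul, Prod.snd_mul, Perm.mul_apply]
    rw [mul_assoc, hy, ← mul_assoc, hx, mul_assoc]
  inv_mem' {x} hx i := by
    simp only [Prod.fst_inv, Prod.snd_inv]
    rw [inv_mul_eq_iff_eq_mul, ← mul_assoc, hx, mul_inv_cancel_right, ← Perm.mul_apply,
      mul_inv_cancel, Perm.one_apply]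

theorem mem_conjGraph {G ι : Type*} [Group G] {s : ι → G} {x : G × Perm ι} :
    x ∈ conjGraph s ↔ ∀ i, x.1 * s i = s (x.2 i) * x.1 := Iff.rfl

theorem syntheme_injective : Function.Injective syntheme := by
  intro i j h
  have := congr($h 0)
  revert i j
  decide

/-- Only the identity commutes with all five synthemes. -/
theorem eq_one_of_commute_syntheme {σ : Perm (Fin 6)} (h : ∀ i, σ * syntheme i = syntheme i * σ) :
    σ = 1 := by
  replace h (i x) : σ (syntheme i x) = syntheme i (σ x) := congr($(h i) x)
  have h₀ : σ 0 = 0 := by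
    have key : ∀ a : Fin 6, (∀ i j k : Fin 5, syntheme i (syntheme j 0) = syntheme k 0 →
      syntheme i (syntheme j a) = syntheme k a) → a = 0 := by decide
    refine key _ fun i j k hijk ↦ ?_
    rw [← h, ← h, ← h, hijk]
  have trans : ∀ x : Fin 6, x = 0 ∨ ∃ i, syntheme i 0 = x := by decide
  ext1 x
  obtain rfl | ⟨i, rfl⟩ := trans x
  · exact h₀
  · rw [h, h₀, Perm.one_apply]

theorem residuePerm_synthemePerm_mem (j : Fin 4) :
    (residuePerm j, synthemePerm j) ∈ conjGraph syntheme := by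
  have : ∀ (j : Fin 4) (i : Fin 5) (x : Fin 6), residuePerm j (syntheme i x) =
    syntheme (synthemePerm j i) (residuePerm j x) := by decide
  exact fun i ↦ Perm.ext (this j i)

theorem closure_synthemePerm : Subgroup.closure (Set.range synthemePerm) = ⊤ := by
  have mem (j) : synthemePerm j ∈ Subgroup.closure (Set.range synthemePerm) :=
    Subgroup.subset_closure ⟨j, rfl⟩
  have hc : synthemePerm 0 * synthemePerm 1 * synthemePerm 0 * synthemePerm 2 =
      List.formPerm [0, 4, 1, 3, 2] := by decide
  rw [eq_top_iff, ← Perm.closure_prime_cycle_swap (by decide)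
    (List.isCycle_formPerm (by decide) (by decide : 2 ≤ [(0 : Fin 5), 4, 1, 3, 2].length))
    (by decide) ⟨1, 4, by decide, rfl⟩, Subgroup.closure_le, ← hc]
  rintro _ (rfl | rfl)
  · exact mul_mem (mul_mem (mul_mem (mem 0) (mem 1)) (mem 0)) (mem 2)
  · exact mem 0

/-- If two coordinate projections are injective on a subgroup of a product containing the pairs
`(f i, g i)`, the subgroups generated by the `f i` and by the `g i` are isomorphic. -/
theorem nonempty_closure_range_mulEquiv {G H ι : Type*} [Group G] [Group H]
    {f : ι → G} {g : ι → H} (R : Subgroup (G × H)) (hR : ∀ i, (f i, g i) ∈ R)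
    (hf : ∀ x : G, (x, 1) ∈ R → x = 1) (hg : ∀ y : H, (1, y) ∈ R → y = 1) :
    Nonempty (Subgroup.closure (Set.range f) ≃* Subgroup.closure (Set.range g)) := by
  let K := Subgroup.closure (Set.range fun i ↦ (f i, g i))
  have hK : K ≤ R := (Subgroup.closure_le _).2 (by rintro _ ⟨i, rfl⟩; exact hR i)
  have h₁ : K.map (MonoidHom.fst G H) = Subgroup.closure (Set.range f) := by
    rw [MonoidHom.map_closure, ← Set.range_comp]
    rfl
  have h₂ : K.map (MonoidHom.snd G H) = Subgroup.closure (Set.range g) := by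
    rw [MonoidHom.map_closure, ← Set.range_comp]
    rfl
  have e₁ : Function.Injective ((MonoidHom.fst G H).subgroupMap K) := by
    rw [injective_iff_map_eq_one]
    rintro ⟨⟨x, y⟩, hxy⟩ h
    obtain rfl : x = 1 := congr_arg Subtype.val h
    obtain rfl := hg y (hK hxy)
    rfl
  have e₂ : Function.Injective ((MonoidHom.snd G H).subgroupMap K) := by
    rw [injective_iff_map_eq_one]
    rintro ⟨⟨x, y⟩, hxy⟩ h
    obtain rfl : y = 1 := congr_arg Subtype.val h
    obtain rfl := hf x (hK hxy)
    rfl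
  rw [← h₁, ← h₂]
  exact ⟨(MulEquiv.ofBijective _ ⟨e₁, MonoidHom.subgroupMap_surjective _ _⟩).symm.trans
    (MulEquiv.ofBijective _ ⟨e₂, MonoidHom.subgroupMap_surjective _ _⟩)⟩

theorem nonempty_closure_residuePerm_mulEquiv :
    Nonempty (Subgroup.closure (Set.range residuePerm) ≃* Perm (Fin 5)) := by
  obtain ⟨e⟩ := nonempty_closure_range_mulEquiv (conjGraph syntheme) residuePerm_synthemePerm_mem
    (fun σ h ↦ eq_one_of_commute_syntheme fun i ↦ by simpa using mem_conjGraph.1 h i)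
    (fun π h ↦ Perm.ext fun i ↦ syntheme_injective <| by
      simpa using (mem_conjGraph.1 h i).symm)
  rw [closure_synthemePerm] at e
  exact ⟨e.trans Subgroup.topEquiv⟩

/-- The subgroup of `Sym(ℤ)` generated by the four class transpositions
`τ_{0(2),1(2)}`, `τ_{0(3),1(3)}`, `τ_{0(3),2(3)}` and `τ_{1(3),2(3)}` is isomorphic to
the symmetric group `S₅`; in particular it has exactly 120 elements. -/
theorem closure_CT2_CT3_iso_S5 (t1 t2 t3 t4 : Equiv.Perm ℤ)
    (h1 : IsClassTransposition t1 0 2 1 2)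
    (h2 : IsClassTransposition t2 0 3 1 3)
    (h3 : IsClassTransposition t3 0 3 2 3)
    (h4 : IsClassTransposition t4 1 3 2 3) :
    Nonempty ((Subgroup.closure {t1, t2, t3, t4} : Subgroup (Equiv.Perm ℤ)) ≃*
      Equiv.Perm (Fin 5)) ∧
    Nat.card (Subgroup.closure {t1, t2, t3, t4} : Subgroup (Equiv.Perm ℤ)) = 120 := by
  have e1 : t1 = blockPerm 6 (residuePerm 0) := eq_blockPerm fun k r ↦ by
    rw [h1.apply_eq_ite]
    fin_cases r <;> simp [residuePerm, swap_apply_def] <;> omega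
  have e2 : t2 = blockPerm 6 (residuePerm 1) := eq_blockPerm fun k r ↦ by
    rw [h2.apply_eq_ite]
    fin_cases r <;> simp [residuePerm, swap_apply_def] <;> omega
  have e3 : t3 = blockPerm 6 (residuePerm 2) := eq_blockPerm fun k r ↦ by
    rw [h3.apply_eq_ite]
    fin_cases r <;> simp [residuePerm, swap_apply_def] <;> omega
  have e4 : t4 = blockPerm 6 (residuePerm 3) := eq_blockPerm fun k r ↦ by
    rw [h4.apply_eq_ite]
    fin_cases r <;> simp [residuePerm, swap_apply_def] <;> omega
  have hmap : Subgroup.closure {t1, t2, t3, t4} =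
      (Subgroup.closure (Set.range residuePerm)).map (blockPerm 6) := by
    rw [MonoidHom.map_closure, ← Set.range_comp, e1, e2, e3, e4]
    congr 1
    ext x
    simp [Fin.exists_fin_succ, eq_comm]
  obtain ⟨e⟩ := nonempty_closure_residuePerm_mulEquiv
  rw [hmap]
  let e' := (Subgroup.equivMapOfInjective _ (blockPerm 6) (blockPerm_injective 6)).symm.trans e
  refine ⟨⟨e'⟩, ?_⟩
  rw [Nat.card_congr e'.toEquiv, Nat.card_perm, Nat.card_fin]
  rfl
end
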